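/- For c ≥ 0, the spectrum of the infinitesimal shift ∂_c on ℍ_c = L²(ℝ, e^{-2ct}dt) equals the closed vertical line {λ ∈ ℂ : Re(λ) = c}. -/

import Mathlib

open MeasureTheory Complex

/-- The weighted Hilbert space measure `μ_c(dt) = e^{-2ct} dt` on `ℝ`. -/
noncomputable def weightedMeasure (c : ℝ) : Measure ℝ :=
  volume.withDensity fun t => ENNReal.ofReal (Real.exp (-2 * c * t))

/-- The weighted Hilbert space `ℍ_c = L²(ℝ, e^{-2ct}dt)`. -/
noncomputable abbrev Hc (c : ℝ) := Lp ℂ 2 (weightedMeasure c)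

/-- `A` is the infinitesimal shift `∂_c` on `ℍ_c`: densely defined, with domain
`{f ∈ ℍ_c ∩ AC(ℝ) : f' ∈ ℍ_c}`, mapping `f ↦ f'`. -/
def IsInfinitesimalShift (c : ℝ) (A : Hc c →ₗ.[ℂ] Hc c) : Prop :=
  Dense (A.domain : Set (Hc c)) ∧
  ∀ f g : Hc c,
    (∃ hf : f ∈ A.domain, A ⟨f, hf⟩ = g) ↔
      ∃ F : ℝ → ℂ, (⇑f : ℝ → ℂ) =ᵐ[weightedMeasure c] F ∧
        ∀ s t : ℝ, F t = F s + ∫ u in s..t, (g : ℝ → ℂ) u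

section InfinitesimalShift

open Set Filter Topology intervalIntegral

theorem IntervalIntegrable.absolutelyContinuousOnInterval_primitive {p : ℝ → ℂ} {a b : ℝ}
    (hp : IntervalIntegrable p volume a b) :
    AbsolutelyContinuousOnInterval (fun x ↦ ∫ u in a..x, p u) a b := by
  have hre : IntervalIntegrable (fun u ↦ (p u).re) volume a b := ⟨hp.1.re, hp.2.re⟩
  have him : IntervalIntegrable (fun u ↦ (p u).im) volume a b := ⟨hp.1.im, hp.2.im⟩
  have hconst (v : ℂ) : AbsolutelyContinuousOnInterval (fun _ : ℝ ↦ v) a b :=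
    (contDiff_const (n := 1)).contDiffOn.absolutelyContinuousOnInterval
  have key := ((hre.absolutelyContinuousOnInterval_intervalIntegral left_mem_uIcc).smul
    (hconst 1)).add ((him.absolutelyContinuousOnInterval_intervalIntegral left_mem_uIcc).smul
    (hconst I))
  rw [absolutelyContinuousOnInterval_iff] at key ⊢
  have heq : ∀ x ∈ uIcc a b, (∫ u in a..x, p u) =
      (((fun x ↦ ∫ u in a..x, (p u).re) • fun _ ↦ 1) +
        ((fun x ↦ ∫ u in a..x, (p u).im) • fun _ ↦ I) : ℝ → ℂ) x := by
    intro x hx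
    have hx' : IntervalIntegrable p volume a x := hp.mono_set (uIcc_subset_uIcc_left hx)
    have h1 := reCLM.intervalIntegral_comp_comm hx'
    have h2 := imCLM.intervalIntegral_comp_comm hx'
    simp only [reCLM_apply, imCLM_apply] at h1 h2
    simp only [Pi.add_apply, Pi.smul_apply', h1, h2, real_smul, mul_one, re_add_im]
  intro ε hε
  obtain ⟨δ, hδ, h⟩ := key ε hε
  refine ⟨δ, hδ, fun E hE hlen ↦ ?_⟩
  convert h E hE hlen using 2 with i hi
  have := hE.1 i (by simpa using hi)
  rw [heq _ this.1, heq _ this.2]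

theorem exp_mul_eq_add_integral {w : ℂ} {p F : ℝ → ℂ}
    (hp : ∀ a b, IntervalIntegrable p volume a b)
    (hF : ∀ s t, F t = F s + ∫ u in s..t, p u) (s t : ℝ) :
    exp (w * t) * F t = exp (w * s) * F s + ∫ u in s..t, exp (w * u) * (p u + w * F u) := by
  have hFs : F = fun x ↦ F s + ∫ u in s..x, p u := funext (hF s)
  have hFcont : Continuous F := by
    rw [hFs]; exact continuous_const.add (continuous_primitive hp s)
  have hint : IntervalIntegrable (fun u ↦ exp (w * u) * (p u + w * F u)) volume s t :=
    ((hp s t).add (Continuous.intervalIntegrable (by fun_prop) s t)).continuousOn_mul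
      (by fun_prop)
  have hconst (v : ℂ) : AbsolutelyContinuousOnInterval (fun _ : ℝ ↦ v) s t :=
    (contDiff_const (n := 1)).contDiffOn.absolutelyContinuousOnInterval
  have hexp : AbsolutelyContinuousOnInterval (fun x : ℝ ↦ exp (w * x)) s t := by
    apply ContDiffOn.absolutelyContinuousOnInterval
    apply ContDiff.contDiffOn
    exact (contDiff_const.mul ofRealCLM.contDiff).cexp
  have hFac : AbsolutelyContinuousOnInterval F s t := by
    rw [hFs]
    exact (hconst (F s)).add (hp s t).absolutelyContinuousOnInterval_primitive
  obtain ⟨C, hC⟩ := ((hexp.smul hFac).sub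
    hint.absolutelyContinuousOnInterval_primitive).const_of_ae_hasDerivAt_zero (by
      filter_upwards [(hp s t).ae_hasDerivAt_integral, hint.ae_hasDerivAt_integral]
        with x hx1 hx2 hx
      have h1 : HasDerivAt F (p x) x := by
        rw [hFs]; exact (hx1 hx s left_mem_uIcc).const_add _
      have h2 : HasDerivAt (fun x : ℝ ↦ exp (w * x)) (exp (w * x) * w) x := by
        have h := ((hasDerivAt_id (x : ℂ)).const_mul w).cexp.comp_ofReal
        simpa using h
      convert! (h2.mul h1).sub (hx2 hx s left_mem_uIcc) using 1
      ring)
  have hs := hC s left_mem_uIcc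
  have ht := hC t right_mem_uIcc
  simp only [Pi.sub_apply, smul_eq_mul, Pi.mul_apply, integral_same, sub_zero] at hs ht
  rw [hs, ← ht]; ring

theorem lintegral_sq_lintegral_sub_mul_le {K G : ℝ → ENNReal} (hK : Measurable K)
    (hG : Measurable G) :
    ∫⁻ t, (∫⁻ s, K (t - s) * G s) ^ 2 ≤ (∫⁻ r, K r) ^ 2 * ∫⁻ s, G s ^ 2 := by
  have hcs (t : ℝ) : (∫⁻ s, K (t - s) * G s) ^ 2 ≤
      (∫⁻ r, K r) * ∫⁻ s, K (t - s) * G s ^ 2 := by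
    have h := ENNReal.lintegral_mul_le_Lp_mul_Lq volume Real.HolderConjugate.two_two
      (f := fun s ↦ K (t - s) ^ (1 / 2 : ℝ)) (g := fun s ↦ K (t - s) ^ (1 / 2 : ℝ) * G s)
      (by fun_prop) (by fun_prop)
    have hsq (x : ENNReal) : (x ^ (1 / 2 : ℝ)) ^ 2 = x := by
      rw [← ENNReal.rpow_natCast, ← ENNReal.rpow_mul]; norm_num
    simp only [Pi.mul_apply, ← mul_assoc, ENNReal.rpow_two, mul_pow, hsq, ← pow_two] at h
    refine (pow_le_pow_left₀ zero_le h 2).trans_eq ?_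
    rw [mul_pow, hsq, hsq, lintegral_sub_left_eq_self]
  calc ∫⁻ t, (∫⁻ s, K (t - s) * G s) ^ 2
      ≤ ∫⁻ t, (∫⁻ r, K r) * ∫⁻ s, K (t - s) * G s ^ 2 := lintegral_mono hcs
    _ = (∫⁻ r, K r) * ∫⁻ t, ∫⁻ s, K (t - s) * G s ^ 2 :=
      lintegral_const_mul _ (Measurable.lintegral_prod_right (by fun_prop))
    _ = (∫⁻ r, K r) * ∫⁻ s, ∫⁻ t, K (t - s) * G s ^ 2 := by
      rw [lintegral_lintegral_swap]; exact Measurable.aemeasurable (by fun_prop)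
    _ = (∫⁻ r, K r) ^ 2 * ∫⁻ s, G s ^ 2 := by
      have h (s : ℝ) : ∫⁻ t, K (t - s) * G s ^ 2 = (∫⁻ r, K r) * G s ^ 2 := by
        rw [lintegral_mul_const _ (by fun_prop), lintegral_sub_right_eq_self K]
      simp_rw [h]
      rw [lintegral_const_mul _ (by fun_prop)]; ring

theorem exists_resolvent_of_bound {E : Type*} [NormedAddCommGroup E] [NormedSpace ℂ E]
    (A : E →ₗ.[ℂ] E) (z : ℂ) (hinj : ∀ f : A.domain, A f - z • (f : E) = 0 → (f : E) = 0) (C : ℝ)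
    (hsurj : ∀ g : E, ∃ f : A.domain, A f - z • (f : E) = g ∧ ‖(f : E)‖ ≤ C * ‖g‖) :
    ∃ B : E →L[ℂ] E, (∀ f : A.domain, B (A f - z • (f : E)) = (f : E)) ∧
      ∀ g : E, ∃ hg : B g ∈ A.domain, A ⟨B g, hg⟩ - z • B g = g := by
  choose R hR hRle using hsurj
  have huniq (f f' : A.domain) (h : A f - z • (f : E) = A f' - z • (f' : E)) : f = f' := by
    have := hinj (f - f') (by
      rw [LinearPMap.map_sub, Submodule.coe_sub, smul_sub, sub_sub_sub_comm, h, sub_self])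
    exact sub_eq_zero.mp (Subtype.ext this)
  let L : E →ₗ[ℂ] E :=
    { toFun g := R g
      map_add' g g' := by
        rw [huniq (R (g + g')) (R g + R g') (by
          rw [hR, LinearPMap.map_add, Submodule.coe_add, smul_add, add_sub_add_comm, hR, hR])]
        rfl
      map_smul' a g := by
        rw [huniq (R (a • g)) (a • R g) (by
          rw [hR, LinearPMap.map_smul, Submodule.coe_smul, smul_comm, ← smul_sub, hR])]
        rfl }
  exact ⟨L.mkContinuous C hRle, fun f ↦ congrArg Subtype.val (huniq _ f (hR _)),
    fun g ↦ ⟨(R g).2, hR g⟩⟩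

theorem ae_weightedMeasure (c : ℝ) : ae (weightedMeasure c) = ae volume := by
  ext s
  change (∀ᵐ t ∂weightedMeasure c, t ∈ s) ↔ ∀ᵐ t, t ∈ s
  rw [weightedMeasure, ae_withDensity_iff (by fun_prop)]
  simp [Real.exp_pos]

theorem eLpNorm_weightedMeasure (c : ℝ) {F : ℝ → ℂ} (hF : Measurable F) :
    eLpNorm F 2 (weightedMeasure c) = eLpNorm (fun t : ℝ ↦ exp (-c * t) * F t) 2 volume := by
  rw [eLpNorm_eq_lintegral_rpow_enorm_toReal (by simp) (by simp),
    eLpNorm_eq_lintegral_rpow_enorm_toReal (by simp) (by simp), weightedMeasure,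
    lintegral_withDensity_eq_lintegral_mul _ (by fun_prop) (by fun_prop)]
  congr 1
  refine lintegral_congr fun t ↦ ?_
  have h : ‖exp (-c * t : ℂ)‖ₑ = ENNReal.ofReal (Real.exp (-c * t)) := by
    rw [← ofReal_norm, norm_exp]; simp
  simp only [Pi.mul_apply, ENNReal.toReal_ofNat, ENNReal.rpow_ofNat, enorm_mul, mul_pow, h,
    ← ENNReal.ofReal_pow (Real.exp_pos _).le, ← Real.exp_nat_mul]
  congr 3
  push_cast; ring

theorem memLp_weightedMeasure_iff (c : ℝ) {F : ℝ → ℂ} (hF : Measurable F) :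
    MemLp F 2 (weightedMeasure c) ↔ MemLp (fun t : ℝ ↦ exp (-c * t) * F t) 2 volume := by
  have h : Measurable fun t : ℝ ↦ exp (-c * t) * F t := by fun_prop
  simp only [MemLp, hF.aestronglyMeasurable, h.aestronglyMeasurable, true_and,
    eLpNorm_weightedMeasure c hF]

theorem measurable_coe_Hc {c : ℝ} (g : Hc c) : Measurable (g : ℝ → ℂ) :=
  (Lp.stronglyMeasurable g).measurable

theorem memLp_exp_mul_coe {c : ℝ} (g : Hc c) :
    MemLp (fun t : ℝ ↦ exp (-c * t) * g t) 2 volume :=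
  (memLp_weightedMeasure_iff c (measurable_coe_Hc g)).mp (Lp.memLp g)

theorem intervalIntegrable_coe_Hc {c : ℝ} (g : Hc c) (a b : ℝ) :
    IntervalIntegrable (g : ℝ → ℂ) volume a b := by
  have h : LocallyIntegrable fun t : ℝ ↦ exp (-c * t) * g t :=
    (memLp_exp_mul_coe g).locallyIntegrable (by norm_num)
  have h' := (h.integrableOn_isCompact (isCompact_uIcc (a := a) (b := b))).intervalIntegrable
  refine (h'.continuousOn_mul (g := fun t : ℝ ↦ exp (c * t)) (by fun_prop)).congr
    fun t _ ↦ ?_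
  simp only [← mul_assoc, ← Complex.exp_add]
  simp

/-- Variation of constants for the infinitesimal shift. -/
theorem IsInfinitesimalShift.sub_smul_eq_iff {c : ℝ} {A : Hc c →ₗ.[ℂ] Hc c}
    (hA : IsInfinitesimalShift c A) (z : ℂ) (f g : Hc c) :
    (∃ hf : f ∈ A.domain, A ⟨f, hf⟩ - z • f = g) ↔
      ∃ F : ℝ → ℂ, (f : ℝ → ℂ) =ᵐ[weightedMeasure c] F ∧ ∀ s t : ℝ,
        exp (-z * t) * F t = exp (-z * s) * F s + ∫ u in s..t, exp (-z * u) * g u := by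
  simp_rw [sub_eq_iff_eq_add]
  rw [hA.2]
  refine exists_congr fun F ↦ and_congr_right fun hF ↦ ?_
  have hae : ((g + z • f : Hc c) : ℝ → ℂ) =ᵐ[volume] fun u ↦ g u + z * F u := by
    rw [EventuallyEq, ← ae_weightedMeasure c]
    filter_upwards [Lp.coeFn_add g (z • f), Lp.coeFn_smul z f, hF] with u h1 h2 h3
    rw [h1, Pi.add_apply, h2, Pi.smul_apply, h3, smul_eq_mul]
  have hint (s t : ℝ) : ∫ u in s..t, (g + z • f : Hc c) u = ∫ u in s..t, (g u + z * F u) :=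
    integral_congr_ae (hae.mono fun u hu _ ↦ hu)
  simp_rw [hint]
  constructor
  · intro h s t
    convert exp_mul_eq_add_integral (w := -z) (fun a b ↦
      (intervalIntegrable_coe_Hc (g + z • f) a b).congr_ae (ae_restrict_of_ae hae)) h s t using 4
    ring
  · intro h s t
    have key := exp_mul_eq_add_integral (w := z) (fun a b ↦
      (intervalIntegrable_coe_Hc g a b).continuousOn_mul (by fun_prop)) h s t
    have hcancel (u : ℝ) (v : ℂ) : exp (z * u) * (exp (-z * u) * v) = v := by
      rw [← mul_assoc, ← Complex.exp_add]; simp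
    convert key using 2
    · exact (hcancel t _).symm
    · exact (hcancel s _).symm
    · refine integral_congr fun u _ ↦ ?_
      simp only [mul_add, hcancel, mul_left_comm (exp (z * u)) z]

theorem eLpNorm_exp_mul_setIntegral_le (c : ℝ) (z : ℂ) {T : Set ℝ} (hT : MeasurableSet T)
    {g : ℝ → ℂ} (hg : Measurable g) :
    eLpNorm (fun t : ℝ ↦ exp (-c * t) *
        (exp (z * t) * ∫ s in (fun s ↦ t - s) ⁻¹' T, exp (-z * s) * g s)) 2 volume ≤
      (∫⁻ r in T, ENNReal.ofReal (Real.exp ((z.re - c) * r))) *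
        eLpNorm (fun t : ℝ ↦ exp (-c * t) * g t) 2 volume := by
  set K : ℝ → ENNReal := T.indicator fun r ↦ ENNReal.ofReal (Real.exp ((z.re - c) * r)) with hKdef
  have hK : Measurable K := Measurable.indicator (by fun_prop) hT
  have hpt (t : ℝ) : ‖exp (-c * t) *
      (exp (z * t) * ∫ s in (fun s ↦ t - s) ⁻¹' T, exp (-z * s) * g s)‖ₑ ≤
      ∫⁻ s, K (t - s) * ‖exp (-c * s) * g s‖ₑ := by
    have hTt : MeasurableSet ((fun s ↦ t - s) ⁻¹' T) := hT.preimage (by fun_prop)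
    rw [← mul_assoc, enorm_mul]
    grw [enorm_integral_le_lintegral_enorm]
    rw [← lintegral_const_mul _ (by fun_prop), ← lintegral_indicator hTt]
    refine (lintegral_congr fun s ↦ ?_).le
    by_cases hs : t - s ∈ T
    · rw [indicator_of_mem (by exact hs), hKdef, indicator_of_mem hs]
      rw [enorm_mul (exp (-z * s)), ← mul_assoc, enorm_mul (exp (-c * s)), ← mul_assoc]
      congr 1
      simp only [← ofReal_norm, norm_mul, norm_exp]
      rw [← ENNReal.ofReal_mul (by positivity), ← ENNReal.ofReal_mul (by positivity),
        ← Real.exp_add, ← Real.exp_add, ← Real.exp_add]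
      congr 2
      simp
      ring
    · rw [indicator_of_notMem (by exact hs), hKdef, indicator_of_notMem hs, zero_mul]
  rw [← lintegral_indicator hT, eLpNorm_eq_lintegral_rpow_enorm_toReal (by simp) (by simp),
    eLpNorm_eq_lintegral_rpow_enorm_toReal (by simp) (by simp)]
  simp only [ENNReal.toReal_ofNat, ENNReal.rpow_ofNat]
  have hle := lintegral_sq_lintegral_sub_mul_le hK (G := fun s ↦ ‖exp (-c * s) * g s‖ₑ)
    (by fun_prop)
  grw [lintegral_mono fun t ↦ pow_le_pow_left₀ zero_le (hpt t) 2, hle]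
  rw [ENNReal.mul_rpow_of_nonneg _ _ (by norm_num), ← ENNReal.rpow_natCast, ← ENNReal.rpow_mul,
    show ((2 : ℕ) : ℝ) * (1 / 2) = 1 by norm_num, ENNReal.rpow_one]

theorem exists_bounded_solution {c : ℝ} {z σ : ℂ} (hσ : ‖σ‖ = 1) {T : Set ℝ}
    (hT : MeasurableSet T)
    (hexp : ∫⁻ r in T, ENNReal.ofReal (Real.exp ((z.re - c) * r)) ≠ ⊤)
    (hsq : ∀ t : ℝ,
      IntegrableOn (fun s ↦ Real.exp (2 * (c - z.re) * s)) ((fun s ↦ t - s) ⁻¹' T))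
    (hσT : ∀ f : ℝ → ℂ, (∀ t : ℝ, IntegrableOn f ((fun s ↦ t - s) ⁻¹' T)) → ∀ s t : ℝ,
      σ * ∫ u in (fun u ↦ t - u) ⁻¹' T, f u =
        σ * (∫ u in (fun u ↦ s - u) ⁻¹' T, f u) + ∫ u in s..t, f u) (g : Hc c) :
    ∃ f : Hc c, ‖f‖ ≤ (∫⁻ r in T, ENNReal.ofReal (Real.exp ((z.re - c) * r))).toReal * ‖g‖ ∧
      ∃ F : ℝ → ℂ, (f : ℝ → ℂ) =ᵐ[weightedMeasure c] F ∧ ∀ s t : ℝ,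
        exp (-z * t) * F t = exp (-z * s) * F s + ∫ u in s..t, exp (-z * u) * g u := by
  have hg := measurable_coe_Hc g
  have hint (t : ℝ) : IntegrableOn (fun s : ℝ ↦ exp (-z * s) * g s) ((fun s ↦ t - s) ⁻¹' T) := by
    have h1 : MemLp (fun s : ℝ ↦ exp ((c - z) * s)) 2
        (volume.restrict ((fun s ↦ t - s) ⁻¹' T)) := by
      rw [memLp_two_iff_integrable_sq_norm (by fun_prop)]
      refine (hsq t).congr (ae_of_all _ fun s ↦ ?_)
      simp only [norm_exp, ← Real.exp_nat_mul]
      simp; ring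
    refine (h1.integrable_mul ((memLp_exp_mul_coe g).restrict _)).congr (ae_of_all _ fun s ↦ ?_)
    simp only [Pi.mul_apply, ← mul_assoc, ← Complex.exp_add]
    ring_nf
  set P : ℝ → ℂ := fun t ↦ ∫ s in (fun s ↦ t - s) ⁻¹' T, exp (-z * s) * g s with hP
  have hprim := hσT _ hint
  have hPcont : Continuous fun t ↦ σ * P t := by
    rw [funext (hprim 0)]
    exact continuous_const.add (continuous_primitive (fun a b ↦
      (intervalIntegrable_coe_Hc g a b).continuousOn_mul (by fun_prop)) 0)
  have hFcont : Continuous fun t : ℝ ↦ exp (z * t) * (σ * P t) := by fun_prop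
  have hle : eLpNorm (fun t : ℝ ↦ exp (z * t) * (σ * P t)) 2 (weightedMeasure c) ≤
      (∫⁻ r in T, ENNReal.ofReal (Real.exp ((z.re - c) * r))) *
        eLpNorm g 2 (weightedMeasure c) := by
    rw [eLpNorm_weightedMeasure c hFcont.measurable, eLpNorm_weightedMeasure c hg]
    refine le_trans (eLpNorm_mono fun t ↦ ?_) (eLpNorm_exp_mul_setIntegral_le c z hT hg)
    simp only [norm_mul, hσ, one_mul]
    rfl
  have hmem : MemLp (fun t : ℝ ↦ exp (z * t) * (σ * P t)) 2 (weightedMeasure c) :=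
    ⟨hFcont.aestronglyMeasurable,
      hle.trans_lt (ENNReal.mul_lt_top hexp.lt_top (Lp.memLp g).2)⟩
  refine ⟨hmem.toLp, ?_, _, hmem.coeFn_toLp, fun s t ↦ ?_⟩
  · rw [Lp.norm_toLp, Lp.norm_def, ← ENNReal.toReal_mul]
    exact ENNReal.toReal_mono (ENNReal.mul_ne_top hexp (Lp.memLp g).2.ne) hle
  · have hcancel (u : ℝ) (v : ℂ) : exp (-z * u) * (exp (z * u) * v) = v := by
      rw [← mul_assoc, ← Complex.exp_add]; simp
    rw [hcancel, hcancel]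
    exact hprim s t

theorem eq_zero_of_integrableOn_const_norm_sq {a : ℂ} {s : Set ℝ} (hs : volume s = ⊤)
    (h : IntegrableOn (fun _ : ℝ ↦ ‖a‖ ^ 2) s) : a = 0 := by
  rw [integrableOn_const_iff (by simp)] at h
  simpa [hs] using h

theorem eq_zero_of_integrable_exp_mul_norm_sq {ρ : ℝ} {a : ℂ}
    (h : Integrable fun t : ℝ ↦ (Real.exp (ρ * t) * ‖a‖) ^ 2) : a = 0 := by
  have hmono {s : Set ℝ} (hs : MeasurableSet s) (hρ : ∀ t ∈ s, 0 ≤ ρ * t) :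
      IntegrableOn (fun _ : ℝ ↦ ‖a‖ ^ 2) s := by
    refine Integrable.mono' (h.integrableOn (s := s)) aestronglyMeasurable_const
      ((ae_restrict_iff' hs).mpr (ae_of_all _ fun t ht ↦ ?_))
    rw [Real.norm_of_nonneg (sq_nonneg _)]
    exact pow_le_pow_left₀ (norm_nonneg _)
      (le_mul_of_one_le_left (norm_nonneg _) (Real.one_le_exp (hρ t ht))) 2
  rcases le_total 0 ρ with hρ | hρ
  · exact eq_zero_of_integrableOn_const_norm_sq (Real.volume_Ici (a := 0))
      (hmono measurableSet_Ici fun t ht ↦ mul_nonneg hρ ht)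
  · exact eq_zero_of_integrableOn_const_norm_sq (Real.volume_Iic (a := 0))
      (hmono measurableSet_Iic fun t ht ↦ mul_nonneg_of_nonpos_of_nonpos hρ ht)

theorem integrable_norm_exp_mul_sq {c : ℝ} (f : Hc c) {F : ℝ → ℂ}
    (hF : (f : ℝ → ℂ) =ᵐ[weightedMeasure c] F) :
    Integrable fun t : ℝ ↦ ‖exp (-c * t) * F t‖ ^ 2 := by
  have h := memLp_exp_mul_coe f
  rw [memLp_two_iff_integrable_sq_norm h.1] at h
  refine h.congr ?_
  rw [ae_weightedMeasure] at hF
  filter_upwards [hF] with t ht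
  rw [ht]

theorem norm_exp_mul_eq (c : ℝ) (z : ℂ) (t : ℝ) (v : ℂ) :
    ‖exp (-c * t) * v‖ = Real.exp ((z.re - c) * t) * ‖exp (-z * t) * v‖ := by
  simp only [norm_mul, norm_exp, ← mul_assoc, ← Real.exp_add]
  congr 2
  simp
  ring

theorem IsInfinitesimalShift.eq_zero_of_sub_smul_eq_zero {c : ℝ} {A : Hc c →ₗ.[ℂ] Hc c}
    (hA : IsInfinitesimalShift c A) (z : ℂ) (f : A.domain) (hf : A f - z • (f : Hc c) = 0) :
    (f : Hc c) = 0 := by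
  obtain ⟨F, hF, hFeq⟩ := (hA.sub_smul_eq_iff z f 0).mp ⟨f.2, hf⟩
  have hconst (t : ℝ) : exp (-z * t) * F t = F 0 := by
    rw [hFeq 0 t, integral_zero_ae]
    · simp
    · have h0 := Lp.coeFn_zero ℂ 2 (weightedMeasure c)
      rw [ae_weightedMeasure] at h0
      filter_upwards [h0] with u hu _
      rw [hu, Pi.zero_apply, mul_zero]
  have hint : Integrable fun t : ℝ ↦ (Real.exp ((z.re - c) * t) * ‖F 0‖) ^ 2 := by
    convert integrable_norm_exp_mul_sq f.1 hF using 3 with t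
    rw [norm_exp_mul_eq c z, hconst]
  have hF0 : F 0 = 0 := eq_zero_of_integrable_exp_mul_norm_sq hint
  rw [Lp.eq_zero_iff_ae_eq_zero]
  filter_upwards [hF] with t ht
  have := hconst t
  rw [ht]
  simpa [hF0] using this

theorem exists_bounded_solution_of_re_ne {c : ℝ} {z : ℂ} (hz : z.re ≠ c) :
    ∃ C : ℝ, ∀ g : Hc c, ∃ f : Hc c, ‖f‖ ≤ C * ‖g‖ ∧
      ∃ F : ℝ → ℂ, (f : ℝ → ℂ) =ᵐ[weightedMeasure c] F ∧ ∀ s t : ℝ,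
        exp (-z * t) * F t = exp (-z * s) * F s + ∫ u in s..t, exp (-z * u) * g u := by
  rcases hz.lt_or_gt with hlt | hgt
  · have hpre (t : ℝ) : (fun s ↦ t - s) ⁻¹' Ici 0 = Iic t := by ext; simp
    refine ⟨_, exists_bounded_solution (σ := 1) (T := Ici 0) (by simp) measurableSet_Ici
      ?_ (fun t ↦ ?_) fun f hf s t ↦ ?_⟩
    · have h := integrableOn_exp_mul_Ioi (sub_neg.mpr hlt) 0
      rw [← integrableOn_Ici_iff_integrableOn_Ioi] at h
      exact h.lintegral_lt_top.ne
    · rw [hpre]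
      exact integrableOn_exp_mul_Iic (by linarith) t
    · simp only [hpre] at hf ⊢
      rw [← integral_Iic_sub_Iic (hf s) (hf t)]; ring
  · have hpre (t : ℝ) : (fun s ↦ t - s) ⁻¹' Iio 0 = Ioi t := by ext; simp
    refine ⟨_, exists_bounded_solution (σ := -1) (T := Iio 0) (by simp) measurableSet_Iio
      ?_ (fun t ↦ ?_) fun f hf s t ↦ ?_⟩
    · have h := integrableOn_exp_mul_Iic (sub_pos.mpr hgt) 0
      rw [integrableOn_Iic_iff_integrableOn_Iio] at h
      exact h.lintegral_lt_top.ne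
    · rw [hpre]
      exact integrableOn_exp_mul_Ioi (by linarith) t
    · simp only [hpre] at hf ⊢
      rw [← integral_Ioi_sub_Ioi' (hf s) (hf t)]; ring

theorem IsInfinitesimalShift.exists_forall_sub_smul_ne {c : ℝ} {A : Hc c →ₗ.[ℂ] Hc c}
    (hA : IsInfinitesimalShift c A) {z : ℂ} (hz : z.re = c) :
    ∃ g : Hc c, ∀ f : A.domain, A f - z • (f : Hc c) ≠ g := by
  have hmeas : Measurable ((Ioc (0 : ℝ) 1).indicator fun t : ℝ ↦ exp (z * t)) :=
    Measurable.indicator (by fun_prop) measurableSet_Ioc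
  have hmem : MemLp ((Ioc (0 : ℝ) 1).indicator fun t : ℝ ↦ exp (z * t)) 2
      (weightedMeasure c) := by
    rw [memLp_weightedMeasure_iff c hmeas]
    have h : MemLp ((Ioc (0 : ℝ) 1).indicator fun _ ↦ (1 : ℝ)) 2 volume :=
      memLp_indicator_const 2 measurableSet_Ioc 1 (by simp)
    refine h.mono (by fun_prop) (ae_of_all _ fun t ↦ ?_)
    by_cases ht : t ∈ Ioc (0 : ℝ) 1
    · rw [norm_exp_mul_eq c z, indicator_of_mem ht, indicator_of_mem ht, ← Complex.exp_add]
      simp [hz]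
    · simp [indicator_of_notMem ht]
  refine ⟨hmem.toLp, fun f hf ↦ ?_⟩
  obtain ⟨F, hF, hFeq⟩ := (hA.sub_smul_eq_iff z f _).mp ⟨f.2, hf⟩
  have hae := hmem.coeFn_toLp
  rw [ae_weightedMeasure] at hae
  have hprim (s t : ℝ) : exp (-z * t) * F t =
      exp (-z * s) * F s + ∫ u in s..t, (Ioc (0 : ℝ) 1).indicator (fun _ ↦ (1 : ℂ)) u := by
    rw [hFeq s t]
    congr 1
    refine integral_congr_ae ?_
    filter_upwards [hae] with u hu _
    rw [hu]
    by_cases h : u ∈ Ioc (0 : ℝ) 1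
    · rw [indicator_of_mem h, indicator_of_mem h, ← Complex.exp_add]; simp
    · simp [indicator_of_notMem h]
  have hint := integrable_norm_exp_mul_sq f.1 hF
  simp_rw [norm_exp_mul_eq c z, hz, sub_self, zero_mul, Real.exp_zero, one_mul] at hint
  have hzero {a : ℂ} {s : Set ℝ} (hs : MeasurableSet s) (htop : volume s = ⊤)
      (h : ∀ t ∈ s, exp (-z * t) * F t = a) : a = 0 :=
    eq_zero_of_integrableOn_const_norm_sq htop
      (hint.integrableOn.congr_fun (fun t ht ↦ by simp only [h t ht]) hs)
  have h0 := hzero measurableSet_Iic (Real.volume_Iic (a := 0)) (a := exp (-z * (0 : ℝ)) * F 0)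
    fun t ht ↦ by
      rw [hprim 0 t, integral_symm, integral_of_le ht, setIntegral_eq_zero_of_forall_eq_zero]
      · simp
      · intro u hu
        exact indicator_of_notMem (fun h ↦ hu.2.not_gt h.1) _
  have h1 := hzero measurableSet_Ici (Real.volume_Ici (a := 1)) (a := 1) fun t ht ↦ by
      have ht' : (1 : ℝ) ≤ t := ht
      rw [hprim 0 t, h0, integral_of_le (zero_le_one.trans ht'),
        setIntegral_indicator measurableSet_Ioc,
        inter_eq_self_of_subset_right (Ioc_subset_Ioc_right ht')]
      simp
  exact one_ne_zero h1

end InfinitesimalShift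

/-- For `c ≥ 0`, the spectrum of the infinitesimal shift `∂_c` (the set of `z ∈ ℂ` such that
`∂_c − z` has no bounded two-sided inverse) equals the closed vertical line `{Re z = c}`. -/
theorem spectrum_infinitesimalShift (c : ℝ) (hc : 0 ≤ c)
    (A : Hc c →ₗ.[ℂ] Hc c) (hA : IsInfinitesimalShift c A) :
    {z : ℂ | ¬ ∃ B : Hc c →L[ℂ] Hc c,
        (∀ f : A.domain, B (A f - z • (f : Hc c)) = (f : Hc c)) ∧
        ∀ g : Hc c, ∃ hg : B g ∈ A.domain, A ⟨B g, hg⟩ - z • B g = g} =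
      {z : ℂ | z.re = c} := by
  ext z
  simp only [Set.mem_ofPred_eq]
  constructor
  · contrapose!
    intro hz
    obtain ⟨C, hC⟩ := exists_bounded_solution_of_re_ne hz
    refine exists_resolvent_of_bound A z (hA.eq_zero_of_sub_smul_eq_zero z) C fun g ↦ ?_
    obtain ⟨f, hfle, hf⟩ := hC g
    obtain ⟨hmem, hfg⟩ := (hA.sub_smul_eq_iff z f g).mpr hf
    exact ⟨⟨f, hmem⟩, hfg, hfle⟩
  · rintro hz ⟨B, -, hB⟩
    obtain ⟨g, hg⟩ := hA.exists_forall_sub_smul_ne hz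
    obtain ⟨hmem, h⟩ := hB g
    exact hg ⟨B g, hmem⟩ h
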